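/- arXiv:math/0206214 — 2 statements merged into one kernel-verified Lean document; each statement's English description precedes it below -/
import Mathlib

section
/- Let a, b ∈ 𝔻 \ {0} be distinct and let γ ∈ ℂ satisfy |γ|² < |ab|. Then log|a| + log|b| < L_{aVbV}(0, γ). (The left-hand side equals the value at (0,γ) of the Lelong–Rashkovskii Green function of the bidisc with poles (a,0), (b,0) and vertical indicators Ψ_V(w) = max{log|w₁|, 2log|w₂|}, which is G_{aVbV}(z) = max{log|φ_a(z₁)| + log|φ_b(z₁)|, 2log|z₂|}; hence G_{aVbV}(0,γ) < L_{aVbV}(0,γ).) -/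
open Complex Metric Filter Topology

noncomputable section

/-- The open unit disc in `ℂ`. -/
def unitDisc : Set ℂ := Metric.ball 0 1

/-- Extended-real logarithm, with the convention `log 0 = ⊥`. -/
def elog (x : ℝ) : EReal := if x = 0 then ⊥ else ((Real.log x : ℝ) : EReal)

/-- The Möbius involution of the unit disc exchanging `ξ` and `0`. -/
def mobius (ξ ζ : ℂ) : ℂ := (ξ - ζ) / (1 - (starRingEnd ℂ) ξ * ζ)

/-- An analytic disc in the bidisc `𝔻²`, given by its two components. -/
def AnalyticDisc2 (φ₁ φ₂ : ℂ → ℂ) : Prop :=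
  DifferentiableOn ℂ φ₁ unitDisc ∧ DifferentiableOn ℂ φ₂ unitDisc ∧
  (∀ w ∈ unitDisc, φ₁ w ∈ unitDisc) ∧ (∀ w ∈ unitDisc, φ₂ w ∈ unitDisc)

/-- The Lempert function with the two simple poles `(a,0)`, `(b,0)` in the bidisc. -/
def La0b0 (a b : ℂ) (z : ℂ × ℂ) : EReal :=
  sInf { t : EReal | ∃ (φ₁ φ₂ : ℂ → ℂ) (ζ₁ ζ₂ : ℂ),
    AnalyticDisc2 φ₁ φ₂ ∧ ζ₁ ∈ unitDisc ∧ ζ₂ ∈ unitDisc ∧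
    φ₁ 0 = z.1 ∧ φ₂ 0 = z.2 ∧
    φ₁ ζ₁ = a ∧ φ₂ ζ₁ = 0 ∧ φ₁ ζ₂ = b ∧ φ₂ ζ₂ = 0 ∧
    t = elog (‖ζ₁‖) + elog (‖ζ₂‖) }

/-- The generalized Lempert function with vertical indicator at `(a,0)` and
simple pole `(b,0)`. -/
def LaVb0 (a b : ℂ) (z : ℂ × ℂ) : EReal :=
  sInf { t : EReal | ∃ (φ₁ φ₂ : ℂ → ℂ) (ζ₁ ζ₂ : ℂ),
    AnalyticDisc2 φ₁ φ₂ ∧ ζ₁ ∈ unitDisc ∧ ζ₂ ∈ unitDisc ∧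
    φ₁ 0 = z.1 ∧ φ₂ 0 = z.2 ∧
    φ₁ ζ₁ = a ∧ φ₂ ζ₁ = 0 ∧ φ₁ ζ₂ = b ∧ φ₂ ζ₂ = 0 ∧
    deriv φ₁ ζ₁ = 0 ∧
    t = elog (‖ζ₁‖) + elog (‖ζ₁‖) + elog (‖ζ₂‖) }

/-- The generalized Lempert function with simple pole `(a,0)` and vertical
indicator at `(b,0)`. -/
def La0bV (a b : ℂ) (z : ℂ × ℂ) : EReal :=
  sInf { t : EReal | ∃ (φ₁ φ₂ : ℂ → ℂ) (ζ₁ ζ₂ : ℂ),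
    AnalyticDisc2 φ₁ φ₂ ∧ ζ₁ ∈ unitDisc ∧ ζ₂ ∈ unitDisc ∧
    φ₁ 0 = z.1 ∧ φ₂ 0 = z.2 ∧
    φ₁ ζ₁ = a ∧ φ₂ ζ₁ = 0 ∧ φ₁ ζ₂ = b ∧ φ₂ ζ₂ = 0 ∧
    deriv φ₁ ζ₂ = 0 ∧
    t = elog (‖ζ₁‖) + elog (‖ζ₂‖) + elog (‖ζ₂‖) }

/-- The generalized Lempert function with vertical indicators at `(a,0)` and `(b,0)`. -/
def LaVbV (a b : ℂ) (z : ℂ × ℂ) : EReal :=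
  sInf { t : EReal | ∃ (φ₁ φ₂ : ℂ → ℂ) (ζ₁ ζ₂ : ℂ),
    AnalyticDisc2 φ₁ φ₂ ∧ ζ₁ ∈ unitDisc ∧ ζ₂ ∈ unitDisc ∧
    φ₁ 0 = z.1 ∧ φ₂ 0 = z.2 ∧
    φ₁ ζ₁ = a ∧ φ₂ ζ₁ = 0 ∧ φ₁ ζ₂ = b ∧ φ₂ ζ₂ = 0 ∧
    deriv φ₁ ζ₁ = 0 ∧ deriv φ₁ ζ₂ = 0 ∧
    t = elog (‖ζ₁‖) + elog (‖ζ₁‖)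
        + elog (‖ζ₂‖) + elog (‖ζ₂‖) }

/-- Coman's Lempert function with the three simple poles `(a,0)`, `(b,0)`, `(b,ε)`. -/
def Leps3 (a b ε : ℂ) (z : ℂ × ℂ) : EReal :=
  sInf { t : EReal | ∃ (φ₁ φ₂ : ℂ → ℂ) (ζ₁ ζ₂ ζ₃ : ℂ),
    AnalyticDisc2 φ₁ φ₂ ∧ ζ₁ ∈ unitDisc ∧ ζ₂ ∈ unitDisc ∧ ζ₃ ∈ unitDisc ∧
    φ₁ 0 = z.1 ∧ φ₂ 0 = z.2 ∧
    φ₁ ζ₁ = a ∧ φ₂ ζ₁ = 0 ∧ φ₁ ζ₂ = b ∧ φ₂ ζ₂ = 0 ∧ φ₁ ζ₃ = b ∧ φ₂ ζ₃ = ε ∧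
    t = elog (‖ζ₁‖) + elog (‖ζ₂‖) + elog (‖ζ₃‖) }

/-- Coman's Lempert function with the four simple poles
`(a,0)`, `(b,0)`, `(b,ε)`, `(a,ε)`. -/
def Leps4 (a b ε : ℂ) (z : ℂ × ℂ) : EReal :=
  sInf { t : EReal | ∃ (φ₁ φ₂ : ℂ → ℂ) (ζ₁ ζ₂ ζ₃ ζ₄ : ℂ),
    AnalyticDisc2 φ₁ φ₂ ∧ ζ₁ ∈ unitDisc ∧ ζ₂ ∈ unitDisc ∧ ζ₃ ∈ unitDisc ∧ ζ₄ ∈ unitDisc ∧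
    φ₁ 0 = z.1 ∧ φ₂ 0 = z.2 ∧
    φ₁ ζ₁ = a ∧ φ₂ ζ₁ = 0 ∧ φ₁ ζ₂ = b ∧ φ₂ ζ₂ = 0 ∧
    φ₁ ζ₃ = b ∧ φ₂ ζ₃ = ε ∧ φ₁ ζ₄ = a ∧ φ₂ ζ₄ = ε ∧
    t = elog (‖ζ₁‖) + elog (‖ζ₂‖)
        + elog (‖ζ₃‖) + elog (‖ζ₄‖) }

lemma mem_uD {z : ℂ} : z ∈ unitDisc ↔ ‖z‖ < 1 := by simp [unitDisc]

lemma uD_open : IsOpen unitDisc := Metric.isOpen_ball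

lemma den_ne {ξ z : ℂ} (hξ : ξ ∈ unitDisc) (hz : z ∈ unitDisc) :
    1 - (starRingEnd ℂ) ξ * z ≠ 0 := by
  rw [mem_uD] at *
  intro h
  have h1 : (starRingEnd ℂ) ξ * z = 1 := (sub_eq_zero.mp h).symm
  have h2 : ‖ξ‖ * ‖z‖ = 1 := by
    have := congrArg norm h1
    simpa using this
  nlinarith [norm_nonneg ξ, norm_nonneg z]

lemma mob_id (ξ z : ℂ) :
    ‖1 - (starRingEnd ℂ) ξ * z‖ ^ 2 - ‖ξ - z‖ ^ 2 = (1 - ‖ξ‖ ^ 2) * (1 - ‖z‖ ^ 2) := by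
  simp only [Complex.sq_norm, Complex.normSq_apply]
  simp
  ring

lemma one_sub_mob {ξ z : ℂ} (hξ : ξ ∈ unitDisc) (hz : z ∈ unitDisc) :
    (1 - ‖mobius ξ z‖ ^ 2) * ‖1 - (starRingEnd ℂ) ξ * z‖ ^ 2
      = (1 - ‖ξ‖ ^ 2) * (1 - ‖z‖ ^ 2) := by
  have h := norm_ne_zero_iff.mpr (den_ne hξ hz)
  rw [← mob_id, mobius, norm_div]
  generalize ‖1 - (starRingEnd ℂ) ξ * z‖ = d at h ⊢
  field_simp

lemma mob_mem {ξ z : ℂ} (hξ : ξ ∈ unitDisc) (hz : z ∈ unitDisc) : mobius ξ z ∈ unitDisc := by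
  have h := norm_pos_iff.mpr (den_ne hξ hz)
  have h1 := one_sub_mob hξ hz
  rw [mem_uD] at *
  by_contra hc
  push Not at hc
  have : 0 < (1 - ‖ξ‖ ^ 2) * (1 - ‖z‖ ^ 2) := by
    apply mul_pos <;> nlinarith [norm_nonneg ξ, norm_nonneg z]
  have h3 : (1 - ‖mobius ξ z‖ ^ 2) ≤ 0 := by nlinarith
  nlinarith [mul_nonneg (neg_nonneg.mpr h3) (sq_nonneg ‖1 - (starRingEnd ℂ) ξ * z‖)]

lemma mob_invol {ξ z : ℂ} (hξ : ξ ∈ unitDisc) (hz : z ∈ unitDisc) :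
    mobius ξ (mobius ξ z) = z := by
  have h := den_ne hξ hz
  have h2 := den_ne hξ hξ
  have h3 : mobius ξ (mobius ξ z) * (1 - (starRingEnd ℂ) ξ * mobius ξ z)
      = ξ - mobius ξ z := by
    rw [mobius, div_mul_cancel₀]
    exact den_ne hξ (mob_mem hξ hz)
  have h4 : z * (1 - (starRingEnd ℂ) ξ * mobius ξ z) = ξ - mobius ξ z := by
    have hw : mobius ξ z * (1 - (starRingEnd ℂ) ξ * z) = ξ - z := by
      rw [mobius, div_mul_cancel₀ _ h]
    linear_combination hw
  exact mul_right_cancel₀ (den_ne hξ (mob_mem hξ hz)) (h3.trans h4.symm)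

lemma mob_hasDeriv {ξ z : ℂ} (hξ : ξ ∈ unitDisc) (hz : z ∈ unitDisc) :
    HasDerivAt (mobius ξ)
      (-(1 - (starRingEnd ℂ) ξ * ξ) / (1 - (starRingEnd ℂ) ξ * z) ^ 2) z := by
  have h := den_ne hξ hz
  have h1 : HasDerivAt (fun z : ℂ => ξ - z) (-1) z := by
    simpa using (hasDerivAt_id z).const_sub ξ
  have h2 : HasDerivAt (fun z : ℂ => 1 - (starRingEnd ℂ) ξ * z) (-((starRingEnd ℂ) ξ)) z := by
    simpa using ((hasDerivAt_id z).const_mul ((starRingEnd ℂ) ξ)).const_sub 1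
  have h3 : HasDerivAt (mobius ξ) _ z := h1.div h2 h
  refine h3.congr_deriv ?_
  congr 1
  ring

lemma mob_diff {ξ : ℂ} (hξ : ξ ∈ unitDisc) : DifferentiableOn ℂ (mobius ξ) unitDisc :=
  fun _ hz => (mob_hasDeriv hξ hz).differentiableAt.differentiableWithinAt

lemma mob_self (ξ : ℂ) : mobius ξ ξ = 0 := by simp [mobius]
lemma mob_zero (ξ : ℂ) : mobius ξ 0 = ξ := by simp [mobius]

lemma norm_den_self {ξ : ℂ} (hξ : ξ ∈ unitDisc) :
    ‖1 - (starRingEnd ℂ) ξ * ξ‖ = 1 - ‖ξ‖ ^ 2 := by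
  rw [mem_uD] at hξ
  have : 1 - (starRingEnd ℂ) ξ * ξ = ((1 - ‖ξ‖ ^ 2 : ℝ) : ℂ) := by
    rw [Complex.conj_mul']; push_cast; ring
  rw [this, Complex.norm_real, Real.norm_of_nonneg]
  nlinarith [norm_nonneg ξ]

lemma diffAt {f : ℂ → ℂ} (hf : DifferentiableOn ℂ f unitDisc) {z : ℂ} (hz : z ∈ unitDisc) :
    DifferentiableAt ℂ f z := hf.differentiableAt (uD_open.mem_nhds hz)

/-- Dividing out a zero. -/
lemma divide {f : ℂ → ℂ} (hf : DifferentiableOn ℂ f unitDisc)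
    (hb : ∀ z ∈ unitDisc, ‖f z‖ ≤ 1) {p : ℂ} (hp : p ∈ unitDisc) (h0 : f p = 0) :
    ∃ g : ℂ → ℂ, DifferentiableOn ℂ g unitDisc ∧ (∀ z ∈ unitDisc, ‖g z‖ ≤ 1) ∧
      ∀ z ∈ unitDisc, f z = mobius p z * g z := by
  set F : ℂ → ℂ := fun z => f (mobius p z) with hF
  have hF0 : F 0 = 0 := by simp [hF, mob_zero, h0]
  have hmaps : Set.MapsTo (mobius p) unitDisc unitDisc := fun z hz => mob_mem hp hz
  have hFd : DifferentiableOn ℂ F unitDisc := hf.comp (mob_diff hp) hmaps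
  have h0m : (0 : ℂ) ∈ unitDisc := by simp [mem_uD]
  have hGd : DifferentiableOn ℂ (dslope F 0) unitDisc :=
    (Complex.differentiableOn_dslope (uD_open.mem_nhds h0m)).mpr hFd
  refine ⟨fun z => dslope F 0 (mobius p z), hGd.comp (mob_diff hp) hmaps, ?_, ?_⟩
  · intro z hz
    have := Complex.norm_dslope_le_div_of_mapsTo_ball (f := F) (c := 0) (R₁ := 1) (R₂ := 1)
      (z := mobius p z) hFd (fun w hw => by
        rw [hF0, mem_closedBall_zero_iff]
        exact hb _ (mob_mem hp hw)) (mob_mem hp hz)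
    simpa using this
  · intro z hz
    have := sub_smul_dslope F 0 (mobius p z)
    rw [hF0] at this
    simp only [sub_zero, smul_eq_mul] at this
    rw [this]
    simp only [hF]
    rw [mob_invol hp hz]

lemma const_or_lt {g : ℂ → ℂ} (hg : DifferentiableOn ℂ g unitDisc)
    (hb : ∀ z ∈ unitDisc, ‖g z‖ ≤ 1) :
    (∀ z ∈ unitDisc, g z ∈ unitDisc) ∨ ∃ c, ∀ z ∈ unitDisc, g z = c := by
  by_cases h : ∀ z ∈ unitDisc, g z ∈ unitDisc
  · exact Or.inl h
  · right
    push Not at h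
    obtain ⟨p, hp, hgp⟩ := h
    rw [mem_uD, not_lt] at hgp
    refine ⟨g p, ?_⟩
    have hmax : IsMaxOn (norm ∘ g) unitDisc p := fun z hz => (hb z hz).trans hgp
    exact Complex.eqOn_of_isPreconnected_of_isMaxOn_norm
      (convex_ball (0:ℂ) 1).isPreconnected uD_open hg hp hmax

/-- Schwarz-Pick, derivative and distance from `0`. -/
lemma schwarz_pick {g : ℂ → ℂ} (hg : DifferentiableOn ℂ g unitDisc)
    (hb : ∀ z ∈ unitDisc, g z ∈ unitDisc) {p : ℂ} (hp : p ∈ unitDisc) :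
    ‖deriv g p‖ * (1 - ‖p‖ ^ 2) ≤ 1 - ‖g p‖ ^ 2 ∧
      ∀ z ∈ unitDisc, ‖mobius (g p) (g z)‖ ≤ ‖mobius p z‖ := by
  obtain ⟨k, hkd, hk1, hk⟩ := divide (f := fun z => mobius (g p) (g z))
    ((mob_diff (hb p hp)).comp hg hb)
    (fun z hz => (mem_uD.mp (mob_mem (hb p hp) (hb z hz))).le) hp (mob_self _)
  constructor
  · have e1 : HasDerivAt (fun z => mobius (g p) (g z)) _ p :=
      (mob_hasDeriv (hb p hp) (hb p hp)).comp p (diffAt hg hp).hasDerivAt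
    have e2 := (mob_hasDeriv hp hp).mul (diffAt hkd hp).hasDerivAt
    have e3 := (e2.congr_of_eventuallyEq
      (f₁ := fun z => mobius (g p) (g z))
      (Filter.eventually_of_mem (uD_open.mem_nhds hp) hk)).unique e1
    rw [mob_self, zero_mul, add_zero] at e3
    have e4 := congrArg norm e3
    simp only [norm_mul, norm_div, norm_neg, norm_pow, norm_den_self hp,
      norm_den_self (hb p hp)] at e4
    have p1 : 0 < 1 - ‖p‖ ^ 2 := by
      have := mem_uD.mp hp; nlinarith [norm_nonneg p]
    have p2 : 0 < 1 - ‖g p‖ ^ 2 := by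
      have := mem_uD.mp (hb p hp); nlinarith [norm_nonneg (g p)]
    have e5 : ‖deriv g p‖ * (1 - ‖p‖ ^ 2) = ‖k p‖ * (1 - ‖g p‖ ^ 2) := by
      field_simp at e4
      linarith
    rw [e5]
    nlinarith [hk1 p hp]
  · intro z hz
    have := hk z hz
    rw [this, norm_mul]
    nlinarith [hk1 z hz, norm_nonneg (mobius p z)]

/-- Dividing out a double zero. -/
lemma double {f : ℂ → ℂ} (hf : DifferentiableOn ℂ f unitDisc)
    (hb : ∀ z ∈ unitDisc, f z ∈ unitDisc) {a p : ℂ} (ha : a ∈ unitDisc) (hp : p ∈ unitDisc)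
    (h0 : f p = a) (hd : deriv f p = 0) :
    ∃ g : ℂ → ℂ, DifferentiableOn ℂ g unitDisc ∧ (∀ z ∈ unitDisc, ‖g z‖ ≤ 1) ∧
      ∀ z ∈ unitDisc, mobius a (f z) = mobius p z ^ 2 * g z := by
  obtain ⟨k, hkd, hk1, hk⟩ := divide (f := fun z => mobius a (f z))
    ((mob_diff ha).comp hf hb)
    (fun z hz => (mem_uD.mp (mob_mem ha (hb z hz))).le) hp (by simp [h0, mob_self])
  have e1 : HasDerivAt (fun z => mobius a (f z)) _ p :=
    (mob_hasDeriv ha (hb p hp)).comp p (diffAt hf hp).hasDerivAt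
  have e2 := (mob_hasDeriv hp hp).mul (diffAt hkd hp).hasDerivAt
  have e3 := (e2.congr_of_eventuallyEq
    (f₁ := fun z => mobius a (f z))
    (Filter.eventually_of_mem (uD_open.mem_nhds hp) hk)).unique e1
  rw [mob_self, zero_mul, add_zero, hd, mul_zero] at e3
  have hkp : k p = 0 := by
    have := den_ne hp hp
    rcases mul_eq_zero.mp e3 with h | h
    · exfalso
      have h2 : -(1 - (starRingEnd ℂ) p * p) / (1 - (starRingEnd ℂ) p * p) ^ 2 ≠ 0 :=
        div_ne_zero (neg_ne_zero.mpr this) (pow_ne_zero _ this)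
      exact h2 h
    · exact h
  obtain ⟨g, hgd, hg1, hg⟩ := divide hkd hk1 hp hkp
  refine ⟨g, hgd, hg1, fun z hz => ?_⟩
  have := hk z hz
  rw [this, hg z hz]; ring

lemma zero_uD : (0 : ℂ) ∈ unitDisc := by simp [mem_uD]

lemma weak {f : ℂ → ℂ} (hf : DifferentiableOn ℂ f unitDisc)
    (hb : ∀ z ∈ unitDisc, f z ∈ unitDisc) {a p : ℂ} (ha : a ∈ unitDisc) (hp : p ∈ unitDisc)
    (hf0 : f 0 = 0) (h0 : f p = a) (hd : deriv f p = 0) : ‖a‖ ≤ ‖p‖ ^ 2 := by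
  obtain ⟨g, hgd, hg1, hg⟩ := double hf hb ha hp h0 hd
  have := hg 0 zero_uD
  rw [hf0, mob_zero, mob_zero] at this
  rw [this, norm_mul, norm_pow]
  nlinarith [hg1 0 zero_uD, sq_nonneg ‖p‖]

lemma real_aux {A B κ s S : ℝ} (hA0 : 0 ≤ A) (hA : A < 1) (hB0 : 0 ≤ B) (hB : B < 1)
    (hκ : 0 < κ) (hκ1 : κ ≤ 1) (hS : S < 1) (hs : s ≤ S)
    (h1 : κ * B ≤ 1 - B ^ 2) (h2 : (1 - s) * (1 - A * B) ^ 2 ≤ (1 - A ^ 2) * (1 - B ^ 2)) :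
    A ≤ 1 - (1 - S) * (κ / 4) ^ 2 / 2 := by
  have hB' : B ≤ 1 - κ / 4 := by
    by_contra hc
    push Not at hc
    nlinarith
  have h3 : κ / 4 ≤ 1 - A * B := by nlinarith
  have h4 : (κ / 4) ^ 2 ≤ (1 - A * B) ^ 2 := by gcongr
  have h5 : (1 - S) * (κ / 4) ^ 2 ≤ (1 - s) * (1 - A * B) ^ 2 := by
    apply mul_le_mul <;> nlinarith [sq_nonneg (κ/4)]
  have h6 : (1 - A ^ 2) * (1 - B ^ 2) ≤ 1 - A ^ 2 := by
    have : 0 ≤ 1 - A ^ 2 := by nlinarith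
    nlinarith [mul_nonneg this (sq_nonneg B)]
  nlinarith

lemma strong {f : ℂ → ℂ} (hf : DifferentiableOn ℂ f unitDisc)
    (hb : ∀ z ∈ unitDisc, f z ∈ unitDisc) {a b p q : ℂ} (ha : a ∈ unitDisc)
    (hp : p ∈ unitDisc) (hq : q ∈ unitDisc) (hab : a ≠ b)
    (hf0 : f 0 = 0) (h0 : f p = a) (hd : deriv f p = 0) (h0' : f q = b) (hd' : deriv f q = 0)
    {R S : ℝ} (hR : R < 1) (hS : S < 1) (hpR : ‖p‖ ^ 2 ≤ R) (hqS : ‖q‖ ^ 2 ≤ S) :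
    ‖a‖ ≤ (1 - (1 - S) * (((1 - R) * (1 - S) / 2) / 4) ^ 2 / 2) * ‖p‖ ^ 2 := by
  obtain ⟨g, hgd, hg1, hg⟩ := double hf hb ha hp h0 hd
  have hbD : b ∈ unitDisc := h0' ▸ hb q hq
  -- nonvanishing at q
  have hne : mobius a b ≠ 0 :=
    div_ne_zero (sub_ne_zero.mpr hab) (den_ne ha hbD)
  have hgq := hg q hq
  rw [h0'] at hgq
  have hmq : mobius p q ≠ 0 := by
    intro h; rw [h] at hgq; simp at hgq; exact hne hgq
  have hgq0 : g q ≠ 0 := by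
    intro h; rw [h] at hgq; simp at hgq; exact hne hgq
  -- derivative at q
  have e1 : HasDerivAt (fun z => mobius a (f z)) _ q :=
    (mob_hasDeriv ha (hb q hq)).comp q (diffAt hf hq).hasDerivAt
  have e2 := ((mob_hasDeriv hp hq).pow 2).mul (diffAt hgd hq).hasDerivAt
  have e3 := (e2.congr_of_eventuallyEq
    (f₁ := fun z => mobius a (f z))
    (Filter.eventually_of_mem (uD_open.mem_nhds hq) hg)).unique e1
  rw [hd', mul_zero] at e3
  set m' := -(1 - (starRingEnd ℂ) p * p) / (1 - (starRingEnd ℂ) p * q) ^ 2 with hm'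
  have e4 : 2 * m' * g q = - (mobius p q * deriv g q) := by
    apply mul_left_cancel₀ hmq
    simp at e3
    linear_combination e3
  have hm'n : ‖m'‖ * ‖1 - (starRingEnd ℂ) p * q‖ ^ 2 = 1 - ‖p‖ ^ 2 := by
    have := norm_ne_zero_iff.mpr (den_ne hp hq)
    rw [hm', norm_div, norm_neg, norm_pow, norm_den_self hp]
    field_simp
  have hden : ‖1 - (starRingEnd ℂ) p * q‖ ≤ 2 := by
    have h1 := norm_sub_le (1:ℂ) ((starRingEnd ℂ) p * q)
    have hp1 := mem_uD.mp hp
    have hq1 := mem_uD.mp hq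
    simp at h1
    nlinarith [norm_nonneg p, norm_nonneg q]
  have hm'b : (1 - R) / 4 ≤ ‖m'‖ := by
    have : ‖1 - (starRingEnd ℂ) p * q‖ ^ 2 ≤ 4 := by
      nlinarith [norm_nonneg (1 - (starRingEnd ℂ) p * q)]
    nlinarith [norm_nonneg m', mul_le_mul_of_nonneg_left this (norm_nonneg m')]
  have hm'0 : m' ≠ 0 := by
    rw [← norm_pos_iff]; linarith
  have e5 : 2 * ‖m'‖ * ‖g q‖ ≤ ‖deriv g q‖ := by
    have := congrArg norm e4
    simp only [norm_neg, norm_mul, Complex.norm_ofNat] at this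
    rw [this]
    have h2 := mem_uD.mp (mob_mem hp hq)
    nlinarith [norm_nonneg (deriv g q)]
  rcases const_or_lt hgd hg1 with hlt | ⟨c, hc⟩
  · have sp1 := (schwarz_pick hgd hlt hq).1
    have sp2 := (schwarz_pick hgd hlt zero_uD).2 q hq
    have hz : ‖mobius 0 q‖ = ‖q‖ := by simp [mobius]
    rw [hz] at sp2
    have id := one_sub_mob (hlt 0 zero_uD) (hlt q hq)
    have hA := mem_uD.mp (hlt 0 zero_uD)
    have hB := mem_uD.mp (hlt q hq)
    have key : ‖g 0‖ ≤ 1 - (1 - S) * (((1 - R) * (1 - S) / 2) / 4) ^ 2 / 2 := by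
      refine real_aux (B := ‖g q‖) (s := ‖q‖ ^ 2) (norm_nonneg _) hA (norm_nonneg _) hB
        ?_ ?_ hS hqS ?_ ?_
      · have : 0 < (1 - R) * (1 - S) := mul_pos (by linarith) (by linarith)
        linarith
      · have : 0 ≤ R := (sq_nonneg _).trans hpR
        have : 0 ≤ S := (sq_nonneg _).trans hqS
        nlinarith
      · calc (1 - R) * (1 - S) / 2 * ‖g q‖ = (2 * ((1 - R) / 4) * ‖g q‖) * (1 - S) := by ring
          _ ≤ (2 * ‖m'‖ * ‖g q‖) * (1 - ‖q‖ ^ 2) := by gcongr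
          _ ≤ ‖deriv g q‖ * (1 - ‖q‖ ^ 2) := by
            gcongr; linarith
          _ ≤ _ := sp1
      · rw [← id]
        have hl : 1 - ‖g 0‖ * ‖g q‖ ≤ ‖1 - (starRingEnd ℂ) (g 0) * g q‖ := by
          have := norm_sub_norm_le (1:ℂ) ((starRingEnd ℂ) (g 0) * g q)
          simpa using this
        have h0 : 0 ≤ 1 - ‖g 0‖ * ‖g q‖ := by
          nlinarith [norm_nonneg (g 0), norm_nonneg (g q)]
        have h1 : ‖mobius (g 0) (g q)‖ ^ 2 ≤ ‖q‖ ^ 2 := by gcongr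
        have h2 : (1 - ‖g 0‖ * ‖g q‖) ^ 2 ≤ ‖1 - (starRingEnd ℂ) (g 0) * g q‖ ^ 2 := by gcongr
        apply mul_le_mul (by linarith) h2 (sq_nonneg _)
        linarith
    have h3 := hg 0 zero_uD
    rw [hf0, mob_zero, mob_zero] at h3
    have h4 := congrArg norm h3
    rw [norm_mul, norm_pow] at h4
    rw [h4, mul_comm]
    gcongr
  · exfalso
    have hc' : g =ᶠ[𝓝 q] fun _ => c := Filter.eventually_of_mem (uD_open.mem_nhds hq) hc
    have hz : deriv g q = 0 := by rw [hc'.deriv_eq]; simp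
    rw [hz] at e4
    simp at e4
    exact e4.elim hm'0 hgq0

/-- Proposition `prop:G2ab<L2ab`: if `|γ|² < |ab|` then
`G_{aVbV}(0,γ) = log|a| + log|b| < L_{aVbV}(0,γ)`. -/
theorem GaVbV_lt_LaVbV
    (a b γ : ℂ) (ha : a ∈ unitDisc) (hb : b ∈ unitDisc)
    (ha0 : a ≠ 0) (hb0 : b ≠ 0) (hab : a ≠ b)
    (hγ : (‖γ‖) ^ 2 < ‖a‖ * ‖b‖) :
    ((Real.log (‖a‖) + Real.log (‖b‖) : ℝ) : EReal)
      < LaVbV a b (0, γ) := by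
  have hap : 0 < ‖a‖ := norm_pos_iff.mpr ha0
  have hbp : 0 < ‖b‖ := norm_pos_iff.mpr hb0
  have ha1 := mem_uD.mp ha
  have hb1 := mem_uD.mp hb
  set R : ℝ := (1 + ‖a‖) / 2 with hR
  set S : ℝ := (1 + ‖b‖) / 2 with hS
  set t : ℝ := 1 - (1 - S) * (((1 - R) * (1 - S) / 2) / 4) ^ 2 / 2 with ht
  have hR1 : 0 < 1 - R := by linarith
  have hS1 : 0 < 1 - S := by linarith
  have ht1 : t < 1 := by
    have : 0 < (1 - S) * (((1 - R) * (1 - S) / 2) / 4) ^ 2 / 2 := by positivity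
    linarith
  have ht0 : 0 < t := by
    have h1 : ((1 - R) * (1 - S) / 2) / 4 ≤ 1 := by nlinarith
    have h0 : 0 ≤ ((1 - R) * (1 - S) / 2) / 4 := by positivity
    have h2 : (((1 - R) * (1 - S) / 2) / 4) ^ 2 ≤ 1 := pow_le_one₀ h0 h1
    nlinarith
  set C : ℝ := min (‖a‖ * ‖b‖ / t) (min (R * ‖b‖) (‖a‖ * S)) with hC
  have habp : 0 < ‖a‖ * ‖b‖ := mul_pos hap hbp
  have hC1 : ‖a‖ * ‖b‖ < C := by
    refine lt_min ?_ (lt_min ?_ ?_)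
    · rw [lt_div_iff₀ ht0]; nlinarith
    · apply mul_lt_mul_of_pos_right _ hbp; linarith
    · apply mul_lt_mul_of_pos_left _ hap; linarith
  have hlog : Real.log ‖a‖ + Real.log ‖b‖ < Real.log C := by
    rw [← Real.log_mul hap.ne' hbp.ne']
    exact Real.log_lt_log habp hC1
  refine lt_of_lt_of_le (EReal.coe_lt_coe_iff.mpr hlog) ?_
  refine le_sInf ?_
  rintro x ⟨f, f₂, p, q, ⟨hf, -, hfb, -⟩, hp, hq, hf0, -, hfp, -, hfq, -, hdp, hdq, rfl⟩
  have hf0 : f 0 = 0 := hf0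
  have wp := weak hf hfb ha hp hf0 hfp hdp
  have wq := weak hf hfb hb hq hf0 hfq hdq
  have hp0 : 0 < ‖p‖ := by
    rcases (norm_nonneg p).eq_or_lt with h | h
    · rw [← h] at wp; norm_num at wp; exact absurd wp ha0
    · exact h
  have hq0 : 0 < ‖q‖ := by
    rcases (norm_nonneg q).eq_or_lt with h | h
    · rw [← h] at wq; norm_num at wq; exact absurd wq hb0
    · exact h
  have hmain : C ≤ ‖p‖ ^ 2 * ‖q‖ ^ 2 := by
    by_cases h1 : ‖p‖ ^ 2 ≤ R
    · by_cases h2 : ‖q‖ ^ 2 ≤ S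
      · have := strong hf hfb ha hp hq hab hf0 hfp hdp hfq hdq
          (by linarith) (by linarith) h1 h2
        refine (min_le_left _ _).trans ?_
        rw [div_le_iff₀ ht0]
        calc ‖a‖ * ‖b‖ ≤ (t * ‖p‖ ^ 2) * ‖q‖ ^ 2 := by gcongr
          _ = _ := by ring
      · refine (min_le_right _ _).trans ((min_le_right _ _).trans ?_)
        push Not at h2
        gcongr
    · refine (min_le_right _ _).trans ((min_le_left _ _).trans ?_)
      push Not at h1
      gcongr
  rw [elog, if_neg hp0.ne', elog, if_neg hq0.ne']
  norm_cast
  have : Real.log ‖p‖ + Real.log ‖p‖ + Real.log ‖q‖ + Real.log ‖q‖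
      = Real.log (‖p‖ ^ 2 * ‖q‖ ^ 2) := by
    rw [Real.log_mul (by positivity) (by positivity), Real.log_pow, Real.log_pow]
    push_cast; ring
  rw [this]
  exact Real.log_le_log (habp.trans hC1) hmain
end
end

section
/- Let a, b ∈ 𝔻 \ {0} be distinct and let γ ∈ ℂ satisfy |γ| < |a| and |γ|² < |ab|. Then log|a| + log|b| < L_{a0bV}(0, γ). (The left-hand side is the value G_{aVbV}(0,γ) of the Lelong–Rashkovskii Green function with poles (a,0), (b,0) and vertical indicators.) -/
open Complex Metric Filter Topology

noncomputable section

lemma mob_den {ξ ζ : ℂ} (hξ : ‖ξ‖ < 1) (hζ : ‖ζ‖ ≤ 1) : 1 - (starRingEnd ℂ) ξ * ζ ≠ 0 := by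
  intro h
  have h1 : (starRingEnd ℂ) ξ * ζ = 1 := (sub_eq_zero.mp h).symm
  have h2 := congrArg norm h1
  rw [norm_mul, RCLike.norm_conj, norm_one] at h2
  nlinarith [norm_nonneg ξ, norm_nonneg ζ]

lemma mob_key {ξ ζ : ℂ} (hξ : ‖ξ‖ < 1) (hζ : ‖ζ‖ ≤ 1) :
    (1 - ‖mobius ξ ζ‖ ^ 2) * ‖1 - (starRingEnd ℂ) ξ * ζ‖ ^ 2
      = (1 - ‖ξ‖ ^ 2) * (1 - ‖ζ‖ ^ 2) := by
  have hd := mob_den hξ hζ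
  have hd' : ‖1 - (starRingEnd ℂ) ξ * ζ‖ ≠ 0 := norm_ne_zero_iff.mpr hd
  have h1 : ‖mobius ξ ζ‖ ^ 2 * ‖1 - (starRingEnd ℂ) ξ * ζ‖ ^ 2 = ‖ξ - ζ‖ ^ 2 := by
    rw [mobius, norm_div, div_pow, div_mul_cancel₀ _ (pow_ne_zero 2 hd')]
  rw [sub_mul, h1, one_mul]
  simp only [Complex.sq_norm, Complex.normSq_apply, Complex.sub_re, Complex.sub_im,
    Complex.mul_re, Complex.mul_im, Complex.conj_re, Complex.conj_im, Complex.one_re,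
    Complex.one_im]
  ring

lemma mob_lt {ξ ζ : ℂ} (hξ : ‖ξ‖ < 1) (hζ : ‖ζ‖ < 1) : ‖mobius ξ ζ‖ < 1 := by
  have h := mob_key hξ hζ.le
  have hd' : 0 < ‖1 - (starRingEnd ℂ) ξ * ζ‖ := norm_pos_iff.mpr (mob_den hξ hζ.le)
  have h1 : 0 < (1 - ‖ξ‖ ^ 2) * (1 - ‖ζ‖ ^ 2) := by
    apply mul_pos <;> nlinarith [norm_nonneg ξ, norm_nonneg ζ]
  rw [← h] at h1
  have h2 := pos_of_mul_pos_left h1 (by positivity)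
  nlinarith [norm_nonneg (mobius ξ ζ)]

lemma mob_le {ξ ζ : ℂ} (hξ : ‖ξ‖ < 1) (hζ : ‖ζ‖ ≤ 1) : ‖mobius ξ ζ‖ ≤ 1 := by
  have h := mob_key hξ hζ
  have hd' : 0 < ‖1 - (starRingEnd ℂ) ξ * ζ‖ := norm_pos_iff.mpr (mob_den hξ hζ)
  have h1 : 0 ≤ (1 - ‖ξ‖ ^ 2) * (1 - ‖ζ‖ ^ 2) := by
    apply mul_nonneg <;> nlinarith [norm_nonneg ξ, norm_nonneg ζ]
  rw [← h] at h1
  have h2 := nonneg_of_mul_nonneg_left h1 (by positivity)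
  nlinarith [norm_nonneg (mobius ξ ζ)]

lemma mob_invol_s10 {ξ ζ : ℂ} (hξ : ‖ξ‖ < 1) (hζ : ‖ζ‖ < 1) : mobius ξ (mobius ξ ζ) = ζ := by
  have hd := mob_den hξ hζ.le
  have hd2 := mob_den hξ (mob_lt hξ hζ).le
  have hx : mobius ξ ζ * (1 - (starRingEnd ℂ) ξ * ζ) = ξ - ζ := by
    rw [mobius, div_mul_cancel₀ _ hd]
  rw [mobius, div_eq_iff hd2]
  apply mul_right_cancel₀ hd
  linear_combination (-1 + ζ * (starRingEnd ℂ) ξ) * hx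

lemma mob_diff_s10 {ξ ζ : ℂ} (hξ : ‖ξ‖ < 1) (hζ : ‖ζ‖ ≤ 1) : DifferentiableAt ℂ (mobius ξ) ζ := by
  have hd := mob_den hξ hζ
  unfold mobius
  fun_prop (disch := assumption)

/-- Schwarz lemma at a double value. -/
lemma double_value {f : ℂ → ℂ} {b ζ : ℂ} (hf : DifferentiableOn ℂ f (ball 0 1))
    (hm : ∀ w ∈ ball (0 : ℂ) 1, ‖f w‖ < 1) (hb : ‖b‖ < 1) (hζ : ‖ζ‖ < 1)
    (h0 : f 0 = 0) (hfb : f ζ = b) (hd : deriv f ζ = 0) : ‖b‖ ≤ ‖ζ‖ ^ 2 := by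
  set F : ℂ → ℂ := fun w => mobius b (f (mobius ζ w)) with hF
  have hball : ∀ w ∈ ball (0 : ℂ) 1, mobius ζ w ∈ ball (0 : ℂ) 1 := by
    intro w hw
    rw [mem_ball_zero_iff] at *
    exact mob_lt hζ hw
  have hfd : ∀ w ∈ ball (0 : ℂ) 1, DifferentiableAt ℂ f w := fun w hw =>
    hf.differentiableAt (isOpen_ball.mem_nhds hw)
  have hFd : DifferentiableOn ℂ F (ball 0 1) := by
    intro w hw
    apply DifferentiableAt.differentiableWithinAt
    have h1 : DifferentiableAt ℂ (mobius ζ) w := mob_diff_s10 hζ (mem_ball_zero_iff.mp hw).le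
    have h2 := hfd _ (hball w hw)
    have h3 : DifferentiableAt ℂ (mobius b) (f (mobius ζ w)) :=
      mob_diff_s10 hb (hm _ (hball w hw)).le
    exact h3.comp w (h2.comp w h1)
  have hF0 : F 0 = 0 := by simp [hF, mob_zero, hfb, mob_self]
  have hFm : Set.MapsTo F (ball 0 1) (closedBall (F 0) 1) := by
    intro w hw
    rw [hF0, mem_closedBall_zero_iff]
    exact mob_le hb (hm _ (hball w hw)).le
  have hder : HasDerivAt F 0 0 := by
    have h1 : DifferentiableAt ℂ (mobius ζ) 0 := mob_diff_s10 hζ (by simp)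
    have h2 : HasDerivAt f 0 (mobius ζ 0) := by
      rw [mob_zero, ← hd]
      exact (hfd ζ (by simpa using hζ)).hasDerivAt
    have h3 : DifferentiableAt ℂ (mobius b) (f (mobius ζ 0)) := by
      rw [mob_zero, hfb]
      exact mob_diff_s10 hb hb.le
    have h4 := h3.hasDerivAt.comp 0 (h2.comp 0 h1.hasDerivAt)
    rw [zero_mul, mul_zero] at h4
    exact h4
  have hlo : (F · - F 0) =o[𝓝 0] (fun w : ℂ ↦ ‖w - 0‖ ^ 1) := by
    have := hasDerivAt_iff_isLittleO.mp hder
    simp only [smul_zero, sub_zero] at this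
    simp only [pow_one, sub_zero]
    exact this.norm_right
  have hz : ζ ∈ ball (0 : ℂ) 1 := by simpa using hζ
  have := Complex.dist_le_mul_div_pow_of_mapsTo_ball_of_isLittleO hFd hFm hlo hz
  rw [hF0] at this
  simpa [hF, mob_self, h0, mob_zero] using this

/-- Schwarz-Pick. -/
lemma schwarz_pick_s10 {g : ℂ → ℂ} {ζ ω : ℂ} (hg : DifferentiableOn ℂ g (ball 0 1))
    (hm : ∀ w ∈ ball (0 : ℂ) 1, ‖g w‖ ≤ 1) (hζ : ‖ζ‖ < 1) (hω : ‖ω‖ < 1)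
    (hc : ‖g ζ‖ < 1) : ‖mobius (g ζ) (g ω)‖ ≤ ‖mobius ζ ω‖ := by
  set F : ℂ → ℂ := fun w => mobius (g ζ) (g (mobius ζ w)) with hF
  have hball : ∀ w ∈ ball (0 : ℂ) 1, mobius ζ w ∈ ball (0 : ℂ) 1 := by
    intro w hw
    rw [mem_ball_zero_iff] at *
    exact mob_lt hζ hw
  have hFd : DifferentiableOn ℂ F (ball 0 1) := by
    intro w hw
    apply DifferentiableAt.differentiableWithinAt
    have h1 : DifferentiableAt ℂ (mobius ζ) w := mob_diff_s10 hζ (mem_ball_zero_iff.mp hw).le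
    have h2 := hg.differentiableAt (isOpen_ball.mem_nhds (hball w hw))
    have h3 : DifferentiableAt ℂ (mobius (g ζ)) (g (mobius ζ w)) :=
      mob_diff_s10 hc (hm _ (hball w hw))
    exact h3.comp w (h2.comp w h1)
  have hF0 : F 0 = 0 := by simp [hF, mob_zero, mob_self]
  have hFm : Set.MapsTo F (ball 0 1) (closedBall 0 1) := by
    intro w hw
    rw [mem_closedBall_zero_iff]
    exact mob_le hc (hm _ (hball w hw))
  have := Complex.norm_le_norm_of_mapsTo_ball hFd hFm hF0 (mob_lt hζ hω)
  simpa [hF, mob_invol_s10 hζ hω] using this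

lemma sp_bound {g : ℂ → ℂ} {ζ ω : ℂ} (hg : DifferentiableOn ℂ g (ball 0 1))
    (hm : ∀ w ∈ ball (0 : ℂ) 1, ‖g w‖ ≤ 1) (hζ : ‖ζ‖ < 1) (hω : ‖ω‖ < 1)
    (hc : ‖g ζ‖ < 1) :
    (1 - ‖g ζ‖) ^ 2 * ((1 - ‖ζ‖ ^ 2) * (1 - ‖ω‖ ^ 2)) / 4 ≤ 1 - ‖g ω‖ ^ 2 := by
  have hgω : ‖g ω‖ ≤ 1 := hm ω (by simpa using hω)
  have h := schwarz_pick_s10 hg hm hζ hω hc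
  have k1 := mob_key hc hgω
  have k2 := mob_key hζ hω.le
  set m := ‖mobius (g ζ) (g ω)‖
  set n := ‖mobius ζ ω‖
  set D := ‖1 - (starRingEnd ℂ) (g ζ) * g ω‖
  set E := ‖1 - (starRingEnd ℂ) ζ * ω‖
  have hm0 : 0 ≤ m := norm_nonneg _
  have hE : E ≤ 2 := by
    refine (norm_sub_le _ _).trans ?_
    rw [norm_mul, RCLike.norm_conj, norm_one]
    nlinarith [norm_nonneg ζ, norm_nonneg ω]
  have hE0 : 0 ≤ E := norm_nonneg _
  have hD : 1 - ‖g ζ‖ ≤ D := by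
    have := norm_sub_norm_le (1 : ℂ) ((starRingEnd ℂ) (g ζ) * g ω)
    rw [norm_mul, RCLike.norm_conj, norm_one] at this
    nlinarith [norm_nonneg (g ζ), norm_nonneg (g ω)]
  have hn1 : n < 1 := mob_lt hζ hω
  have hn0 : 0 ≤ n := norm_nonneg _
  have hmn : m ^ 2 ≤ n ^ 2 := by gcongr
  have hn2 : 0 ≤ 1 - n ^ 2 := by nlinarith
  have s1 : (1 - ‖ζ‖ ^ 2) * (1 - ‖ω‖ ^ 2) / 4 ≤ 1 - n ^ 2 := by
    rw [← k2]
    have : E ^ 2 ≤ 4 := by nlinarith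
    nlinarith
  have s2 : (1 - n ^ 2) * (1 - ‖g ζ‖) ^ 2 ≤ (1 - m ^ 2) * D ^ 2 := by
    have : 0 ≤ 1 - ‖g ζ‖ := by linarith
    apply mul_le_mul <;> first | positivity | nlinarith
  rw [k1] at s2
  have s3 : (1 - ‖g ζ‖ ^ 2) * (1 - ‖g ω‖ ^ 2) ≤ 1 - ‖g ω‖ ^ 2 := by
    have : 0 ≤ 1 - ‖g ω‖ ^ 2 := by nlinarith [norm_nonneg (g ω)]
    nlinarith [sq_nonneg ‖g ζ‖]
  have s4 := mul_le_mul_of_nonneg_right s1 (sq_nonneg (1 - ‖g ζ‖))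
  linarith

set_option maxHeartbeats 1000000 in
/-- Uniform numerical gap. -/
lemma num_gap {A B : ℝ} (hA : 0 < A) (hA1 : A < 1) (hB : 0 < B) (hB1 : B < 1) :
    ∃ m, A * B < m ∧ ∀ p q : ℝ, A ≤ p → p < 1 → 0 < q → q < 1 → B ≤ q ^ 2 →
      (1 - B / q) ^ 2 * ((1 - q ^ 2) * (1 - p ^ 2)) / 4 ≤ 1 - (A / p) ^ 2 → m ≤ p * (q * q) := by
  obtain ⟨s, hs0, hs2⟩ : ∃ s : ℝ, 0 ≤ s ∧ s ^ 2 = (1 + B) / 2 :=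
    ⟨Real.sqrt ((1 + B) / 2), Real.sqrt_nonneg _, Real.sq_sqrt (by linarith)⟩
  have hs1 : s < 1 := by nlinarith
  obtain ⟨P, hAP, hP1⟩ := exists_between hA1
  obtain ⟨κ, hκ⟩ : ∃ κ, κ = (1 - s) ^ 2 * ((1 - s ^ 2) * (1 - P ^ 2)) / 4 := ⟨_, rfl⟩
  have hκ0 : 0 < κ := by
    have h1 : 0 < 1 - s := by linarith
    have h2 : 0 < 1 - s ^ 2 := by nlinarith
    have h3 : 0 < 1 - P ^ 2 := by nlinarith
    rw [hκ]
    positivity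
  obtain ⟨R, hR⟩ : ∃ R, R = A * Real.sqrt (1 + κ) := ⟨_, rfl⟩
  have hsq : 1 < Real.sqrt (1 + κ) := by
    rw [Real.lt_sqrt (by norm_num)]; linarith
  have hRA : A < R := by nlinarith
  refine ⟨min (P * B) (min (A * s ^ 2) (R * B)), ?_, ?_⟩
  · rw [lt_min_iff, lt_min_iff]
    refine ⟨by nlinarith, by nlinarith, by nlinarith⟩
  intro p q hAp hp1 hq0 hq1 hBq h
  have hp0 : 0 < p := by linarith
  rcases le_or_gt P p with hPp | hPp
  · apply (min_le_left _ _).trans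
    rw [← pow_two]
    apply mul_le_mul hPp hBq hB.le hp0.le
  apply (min_le_right _ _).trans
  rcases le_or_gt s q with hsq' | hsq'
  · apply (min_le_left _ _).trans
    rw [← pow_two]
    gcongr
  apply (min_le_right _ _).trans
  rw [← pow_two]
  refine mul_le_mul ?_ hBq hB.le hp0.le
  have hBq' : B / q ≤ q := by rw [div_le_iff₀ hq0]; nlinarith
  have hk : κ ≤ (1 - B / q) ^ 2 * ((1 - q ^ 2) * (1 - p ^ 2)) / 4 := by
    have h1 : 0 ≤ 1 - s := by linarith
    have h2 : 0 ≤ 1 - s ^ 2 := by nlinarith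
    have h3 : 0 ≤ 1 - P ^ 2 := by nlinarith
    have h4 : 1 - s ≤ 1 - B / q := by linarith
    have h5 : 1 - s ^ 2 ≤ 1 - q ^ 2 := by nlinarith
    have h6 : 1 - P ^ 2 ≤ 1 - p ^ 2 := by nlinarith
    have h7 : 0 ≤ 1 - q ^ 2 := h2.trans h5
    have h8 : (1 - s) ^ 2 ≤ (1 - B / q) ^ 2 := pow_le_pow_left₀ h1 h4 2
    have h9 := mul_le_mul h5 h6 h3 h7
    have h10 := mul_le_mul h8 h9 (mul_nonneg h2 h3) (sq_nonneg (1 - B / q))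
    rw [hκ]
    linarith
  have hk2 : κ ≤ 1 - (A / p) ^ 2 := hk.trans h
  have hAp2 : (A / p) ^ 2 * p ^ 2 = A ^ 2 := by field_simp
  have hfin : A ^ 2 * (1 + κ) ≤ p ^ 2 := by
    have e1 : κ * p ^ 2 ≤ p ^ 2 - A ^ 2 := by
      have := mul_le_mul_of_nonneg_right hk2 (sq_nonneg p)
      linarith
    have e2 : A ^ 2 ≤ p ^ 2 := pow_le_pow_left₀ hA.le hAp 2
    have e3 := mul_le_mul_of_nonneg_left e2 hκ0.le
    linarith
  have : R ^ 2 ≤ p ^ 2 := by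
    rw [hR, mul_pow, Real.sq_sqrt (by linarith)]; exact hfin
  exact (sq_le_sq₀ (by linarith) hp0.le).mp this

/-- Proposition `prop:G2ab<L2b`: if `|γ| < |a|` and `|γ|² < |ab|` then
`G_{aVbV}(0,γ) = log|a| + log|b| < L_{a0bV}(0,γ)`. -/
theorem GaVbV_lt_La0bV
    (a b γ : ℂ) (ha : a ∈ unitDisc) (hb : b ∈ unitDisc)
    (ha0 : a ≠ 0) (hb0 : b ≠ 0) (hab : a ≠ b)
    (hγa : ‖γ‖ < ‖a‖)
    (hγ : (‖γ‖) ^ 2 < ‖a‖ * ‖b‖) :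
    ((Real.log (‖a‖) + Real.log (‖b‖) : ℝ) : EReal)
      < La0bV a b (0, γ) := by
  have hA1 : ‖a‖ < 1 := by simpa [unitDisc] using ha
  have hB1 : ‖b‖ < 1 := by simpa [unitDisc] using hb
  have hA0 : 0 < ‖a‖ := norm_pos_iff.mpr ha0
  have hB0 : 0 < ‖b‖ := norm_pos_iff.mpr hb0
  obtain ⟨m, hm, hgap⟩ := num_gap hA0 hA1 hB0 hB1
  have hm0 : 0 < m := lt_trans (mul_pos hA0 hB0) hm
  have hlt : ((Real.log (‖a‖) + Real.log (‖b‖) : ℝ) : EReal) < ((Real.log m : ℝ) : EReal) := by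
    rw [EReal.coe_lt_coe_iff, ← Real.log_mul hA0.ne' hB0.ne']
    exact Real.log_lt_log (mul_pos hA0 hB0) hm
  refine hlt.trans_le ?_
  apply le_sInf
  rintro t ⟨φ₁, φ₂, ζ₁, ζ₂, ⟨hd1, -, hm1, -⟩, hζ₁, hζ₂, h0, -, h1a, -, h2b, -, hder, rfl⟩
  have hz1 : ‖ζ₁‖ < 1 := by simpa [unitDisc] using hζ₁
  have hz2 : ‖ζ₂‖ < 1 := by simpa [unitDisc] using hζ₂
  have h0' : φ₁ 0 = 0 := h0
  have hne1 : ζ₁ ≠ 0 := by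
    rintro rfl
    exact ha0 (h1a.symm.trans h0')
  have hne2 : ζ₂ ≠ 0 := by
    rintro rfl
    exact hb0 (h2b.symm.trans h0')
  have hp0 : 0 < ‖ζ₁‖ := norm_pos_iff.mpr hne1
  have hq0 : 0 < ‖ζ₂‖ := norm_pos_iff.mpr hne2
  have hmaps : ∀ w ∈ ball (0 : ℂ) 1, ‖φ₁ w‖ < 1 := fun w hw => by
    simpa [unitDisc] using hm1 w hw
  have hd : DifferentiableOn ℂ φ₁ (ball 0 1) := hd1
  have hMT : Set.MapsTo φ₁ (ball 0 1) (closedBall (φ₁ 0) 1) := by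
    intro w hw
    rw [h0', mem_closedBall_zero_iff]
    exact (hmaps w hw).le
  have hgd : DifferentiableOn ℂ (dslope φ₁ 0) (ball 0 1) :=
    (Complex.differentiableOn_dslope (ball_mem_nhds 0 one_pos)).mpr hd
  have hgm : ∀ w ∈ ball (0 : ℂ) 1, ‖dslope φ₁ 0 w‖ ≤ 1 := fun w hw => by
    simpa using Complex.norm_dslope_le_div_of_mapsTo_ball hd hMT hw
  have hg1 : ‖dslope φ₁ 0 ζ₁‖ = ‖a‖ / ‖ζ₁‖ := by
    rw [dslope_of_ne _ hne1, slope_def_field, h1a, h0']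
    simp
  have hg2 : ‖dslope φ₁ 0 ζ₂‖ = ‖b‖ / ‖ζ₂‖ := by
    rw [dslope_of_ne _ hne2, slope_def_field, h2b, h0']
    simp
  have hbq : ‖b‖ ≤ ‖ζ₂‖ ^ 2 := double_value hd hmaps hB1 hz2 h0' h2b hder
  have hap : ‖a‖ ≤ ‖ζ₁‖ := by
    have := hgm ζ₁ hζ₁
    rwa [hg1, div_le_one hp0] at this
  have hc : ‖dslope φ₁ 0 ζ₂‖ < 1 := by
    rw [hg2, div_lt_one hq0]
    nlinarith
  have hsp := sp_bound hgd hgm hz2 hz1 hc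
  rw [hg1, hg2] at hsp
  have hfin := hgap ‖ζ₁‖ ‖ζ₂‖ hap hz1 hq0 hz2 hbq hsp
  rw [elog, elog, if_neg hp0.ne', if_neg hq0.ne', ← EReal.coe_add, ← EReal.coe_add,
    EReal.coe_le_coe_iff, add_assoc, ← Real.log_mul hq0.ne' hq0.ne',
    ← Real.log_mul hp0.ne' (mul_pos hq0 hq0).ne']
  exact Real.log_le_log hm0 hfin
end
end
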